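/- Let d = √17 and let U be the 5×5 real matrix with rows r₁ = (√((1+d)/8), 0, 0, √((7−d)/8), 0), r₂ = (0, √((1+d)/8), 0, 0, √((7−d)/8)), r₃ = (√(d−4), (d−3)/4, √((5−d)/2), −√(5−d)/2, −√((d−3)/8)), r₄ = (−√((5d−19)/8), 0, √((5−d)/2), √((7−d)/8), 0), r₅ = (−√(29−7d)/2, √(d−3)/2, −√(d−4), √((d−4)/2), −1/√2). Then U is an orthogonal matrix, i.e. U·Uᵀ = I₅ (equivalently, the rows of U form an orthonormal basis of ℝ⁵). -/

import Mathlib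

open Matrix Real

/-- The `5×5` block `u^{(A₂,a₁)}` of the bi-unitary connection on the large double
broom (with `d = √17`) is an orthogonal matrix: `U · Uᵀ = 1`. -/
theorem largeDoubleBroom_block_u_A2_a1_orthogonal (d : ℝ) (hd : d = Real.sqrt 17)
    (U : Matrix (Fin 5) (Fin 5) ℝ)
    (hU : U = !![Real.sqrt ((1 + d)/8), 0, 0, Real.sqrt ((7 - d)/8), 0;
                 0, Real.sqrt ((1 + d)/8), 0, 0, Real.sqrt ((7 - d)/8);
                 Real.sqrt (d - 4), (d - 3)/4, Real.sqrt ((5 - d)/2),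
                   -Real.sqrt (5 - d)/2, -Real.sqrt ((d - 3)/8);
                 -Real.sqrt ((5*d - 19)/8), 0, Real.sqrt ((5 - d)/2),
                   Real.sqrt ((7 - d)/8), 0;
                 -Real.sqrt (29 - 7*d)/2, Real.sqrt (d - 3)/2, -Real.sqrt (d - 4),
                   Real.sqrt ((d - 4)/2), -1/Real.sqrt 2]) :
    U * Uᵀ = 1 := by
  have hdd : d ^ 2 = 17 := by rw [hd]; exact Real.sq_sqrt (by norm_num)
  have hd4 : 4 < d := by rw [hd]; exact Real.lt_sqrt_of_sq_lt (by norm_num)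
  have hd5 : d < 5 := by nlinarith
  obtain ⟨x, hx⟩ : ∃ x, x = Real.sqrt (d - 4) := ⟨_, rfl⟩
  obtain ⟨y, hy⟩ : ∃ y, y = Real.sqrt ((5 - d)/2) := ⟨_, rfl⟩
  obtain ⟨z, hz⟩ : ∃ z, z = Real.sqrt 2 := ⟨_, rfl⟩
  have hx0 : 0 < x := hx ▸ Real.sqrt_pos.2 (by linarith)
  have hy0 : 0 < y := hy ▸ Real.sqrt_pos.2 (by linarith)
  have hz0 : 0 < z := hz ▸ Real.sqrt_pos.2 (by norm_num)
  have hx2 : x ^ 2 = d - 4 := hx ▸ Real.sq_sqrt (by linarith)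
  have hy2 : y ^ 2 = (5 - d)/2 := hy ▸ Real.sq_sqrt (by linarith)
  have hz2 : z ^ 2 = 2 := hz ▸ Real.sq_sqrt (by norm_num)
  have hsqrt : ∀ {a b : ℝ}, 0 ≤ b → b ^ 2 = a → Real.sqrt a = b :=
    fun hb h => h ▸ Real.sqrt_sq hb
  have e1 : Real.sqrt ((1 + d)/8) = (5 + d)/4 * x := hsqrt (by positivity) (by grind)
  have e2 : Real.sqrt ((7 - d)/8) = (1 + d)/8 * (y * z) := hsqrt (by positivity) (by grind)
  have e3 : Real.sqrt (5 - d) = y * z := hsqrt (by positivity) (by grind)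
  have e4 : Real.sqrt ((d - 3)/8) = (5 + d)/8 * (x * y * z) := hsqrt (by positivity) (by grind)
  have e5 : Real.sqrt ((5*d - 19)/8) = (1 + d)/4 * x := hsqrt (by positivity) (by grind)
  have e6 : Real.sqrt (29 - 7*d) = (d - 3)/2 * y :=
    hsqrt (mul_nonneg (by linarith) hy0.le) (by grind)
  have e7 : Real.sqrt (d - 3) = (5 + d)/2 * (x * y) := hsqrt (by positivity) (by grind)
  have e8 : Real.sqrt ((d - 4)/2) = x * z / 2 := hsqrt (by positivity) (by grind)
  have e9 : -1 / z = -z / 2 := by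
    field_simp
    linarith
  rw [e1, e2, e3, e4, e5, e6, e7, e8, ← hx, ← hy, ← hz, e9] at hU
  clear e1 e2 e3 e4 e5 e6 e7 e8 e9 hsqrt hx hy hz hd
  subst hU
  ext i j
  fin_cases i <;> fin_cases j <;>
    simp [Matrix.mul_apply, Fin.sum_univ_five] <;> grind
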